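/- arXiv:2309.05182 — 3 statements merged into one kernel-verified Lean document; each statement's English description precedes it below -/
import Mathlib

section
/- Fix ε ∈ (0,1) and suppose (1−ε/2)·n/k ≥ 4/ε (as holds for all sufficiently large n). Let σ : [n] → [k] satisfy (1−ε/2)·n/k ≤ |V_r| ≤ (1+ε/2)·n/k for all r ∈ [k], let π_* and π be permutations of [n] with lifted permutations τ_* = ℓ(π_*) and τ = ℓ(π), and let x_r = |{i ∈ V_r : π(i) ≠ π_*(i)}| for r ∈ [k]. Then, without any restriction on the x_r, M⁺(τ) ≥ (1−ε)·(n/(2k))·(x_1+⋯+x_k) and M⁻(τ) ≥ (1−ε)·((k−1)·n/(2k))·(x_1+⋯+x_k). -/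
open Finset Filter

namespace CSBM

/-- Unordered pairs of distinct vertices of `[n]`, encoded as ordered pairs `(i,j)` with `i < j`. -/
abbrev Edge (n : ℕ) := {e : Fin n × Fin n // e.1 < e.2}

/-- Bernoulli weight: probability of outcome `b` under a `Bernoulli(p)` variable. -/
noncomputable def bern (p : ℝ) (b : Bool) : ℝ := if b then p else 1 - p

/-- Edge indicator between two vertices for a graph encoded on ordered pairs `i < j`. -/
def adj {n : ℕ} (g : Edge n → Bool) (i j : Fin n) : Bool :=
  if h : i < j then g ⟨(i, j), h⟩ else if h' : j < i then g ⟨(j, i), h'⟩ else false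

/-- The lifted permutation `ℓ(π)` acting on unordered pairs. -/
def lift {n : ℕ} (π : Equiv.Perm (Fin n)) (e : Edge n) : Edge n :=
  if h : π e.1.1 < π e.1.2 then ⟨(π e.1.1, π e.1.2), h⟩
  else ⟨(π e.1.2, π e.1.1),
    lt_of_le_of_ne (not_lt.mp h) fun hc => e.2.ne' (π.injective hc)⟩

/-- Outcome of the correlated SBM: community labels, parent graph, and two subsampling masks. -/
abbrev Omega (n k : ℕ) := (Fin n → Fin k) × (Edge n → Bool) × (Edge n → Bool) × (Edge n → Bool)

/-- Joint density (probability mass) of `CSBM(n,p,q,k,s)`: labels i.i.d. uniform on `[k]`,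
parent edges Bernoulli `p`/`q` according to labels, two independent `s`-subsampling masks. -/
noncomputable def density (n k : ℕ) (p q s : ℝ) (ω : Omega n k) : ℝ :=
  ((k : ℝ))⁻¹ ^ n
    * (∏ e : Edge n, bern (if ω.1 e.1.1 = ω.1 e.1.2 then p else q) (ω.2.1 e))
    * (∏ e : Edge n, bern s (ω.2.2.1 e))
    * (∏ e : Edge n, bern s (ω.2.2.2 e))

/-- Probability of an event under `CSBM(n,p,q,k,s)` (with the ground-truth permutation being
a fixed parameter, entering only through observables). -/
noncomputable def Pr (n k : ℕ) (p q s : ℝ) (A : Set (Omega n k)) : ℝ :=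
  ∑ ω : Omega n k, Set.indicator A (density n k p q s) ω

/-- Adjacency matrix of `G₁` (first subsample of the parent graph). -/
def G1adj {n k : ℕ} (ω : Omega n k) : Fin n → Fin n → Bool :=
  fun i j => adj ω.2.1 i j && adj ω.2.2.1 i j

/-- Adjacency matrix of `G₂'` (second subsample of the parent graph, unpermuted). -/
def G2primeAdj {n k : ℕ} (ω : Omega n k) : Fin n → Fin n → Bool :=
  fun i j => adj ω.2.1 i j && adj ω.2.2.2 i j

/-- Adjacency matrix of `G₂`: the second subsample with vertices relabeled by `π`. -/
def G2adj {n k : ℕ} (π : Equiv.Perm (Fin n)) (ω : Omega n k) : Fin n → Fin n → Bool :=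
  fun i j => G2primeAdj ω (π.symm i) (π.symm j)

/-- Alignment score `Σ_{i<j} A_{i,j} B_{π(i),π(j)}`. -/
def align {n : ℕ} (A B : Fin n → Fin n → Bool) (π : Equiv.Perm (Fin n)) : ℕ :=
  ∑ e : Edge n, (if A e.1.1 e.1.2 && B (π e.1.1) (π e.1.2) then 1 else 0)


/-- Outcome of the correlated SBM conditionally on the labels: parent graph and two masks. -/
abbrev CondOmega (n : ℕ) := (Edge n → Bool) × (Edge n → Bool) × (Edge n → Bool)

/-- Conditional density of the correlated SBM given the community labeling `σ`. -/
noncomputable def condDensity (n k : ℕ) (σ : Fin n → Fin k) (p q s : ℝ)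
    (ω : CondOmega n) : ℝ :=
  (∏ e : Edge n, bern (if σ e.1.1 = σ e.1.2 then p else q) (ω.1 e))
    * (∏ e : Edge n, bern s (ω.2.1 e))
    * (∏ e : Edge n, bern s (ω.2.2 e))

/-- Conditional probability of an event given the labels `σ` (and the ground truth `π⋆`,
which enters only through observables). -/
noncomputable def condPr (n k : ℕ) (σ : Fin n → Fin k) (p q s : ℝ)
    (A : Set (CondOmega n)) : ℝ :=
  ∑ ω : CondOmega n, Set.indicator A (condDensity n k σ p q s) ω

/-- Adjacency matrix of `G₁` in the conditional model. -/
def G1adjC {n : ℕ} (ω : CondOmega n) : Fin n → Fin n → Bool :=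
  fun i j => adj ω.1 i j && adj ω.2.1 i j

/-- Adjacency matrix of `G₂` (second subsample, relabeled by `π⋆`) in the conditional model. -/
def G2adjC {n : ℕ} (πstar : Equiv.Perm (Fin n)) (ω : CondOmega n) : Fin n → Fin n → Bool :=
  fun i j => adj ω.1 (πstar.symm i) (πstar.symm j) && adj ω.2.2 (πstar.symm i) (πstar.symm j)

/-- `|V_r|`: size of the `r`-th community. -/
def Vcard {n k : ℕ} (σ : Fin n → Fin k) (r : Fin k) : ℕ :=
  (univ.filter fun i => σ i = r).card

/-- `x_r`: number of vertices of community `r` mismatched by `π` relative to `π⋆`. -/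
def xcount {n k : ℕ} (σ : Fin n → Fin k) (πstar π : Equiv.Perm (Fin n)) (r : Fin k) : ℕ :=
  (univ.filter fun i => σ i = r ∧ π i ≠ πstar i).card

/-- `M⁺(τ)`: number of intra-community pairs moved differently by `ℓ(π)` and `ℓ(π⋆)`. -/
def Mplus {n k : ℕ} (σ : Fin n → Fin k) (πstar π : Equiv.Perm (Fin n)) : ℕ :=
  (univ.filter fun e : Edge n => σ e.1.1 = σ e.1.2 ∧ lift π e ≠ lift πstar e).card

/-- `M⁻(τ)`: number of inter-community pairs moved differently by `ℓ(π)` and `ℓ(π⋆)`. -/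
def Mminus {n k : ℕ} (σ : Fin n → Fin k) (πstar π : Equiv.Perm (Fin n)) : ℕ :=
  (univ.filter fun e : Edge n => σ e.1.1 ≠ σ e.1.2 ∧ lift π e ≠ lift πstar e).card


theorem lift_ne_of {n : ℕ} (πstar π : Equiv.Perm (Fin n)) (e : Edge n)
    (h1 : ¬ (π e.1.1 = πstar e.1.1 ∧ π e.1.2 = πstar e.1.2))
    (h2 : ¬ (π e.1.1 = πstar e.1.2 ∧ π e.1.2 = πstar e.1.1)) :
    lift π e ≠ lift πstar e := by
  intro h
  unfold lift at h
  split_ifs at h <;> simp only [Subtype.mk.injEq, Prod.mk.injEq] at h <;> tauto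

theorem count_general {n : ℕ} (R : Fin n → Fin n → Prop) [∀ i j, Decidable (R i j)]
    (hR : ∀ i j, R i j → R j i) (πstar π : Equiv.Perm (Fin n)) (c : ℝ)
    (hc : ∀ i, c + 1 ≤ ((univ.filter fun j => j ≠ i ∧ R i j).card : ℝ)) :
    c * ((univ.filter fun i => π i ≠ πstar i).card : ℝ) ≤
      2 * ((univ.filter fun e : Edge n => R e.1.1 e.1.2 ∧ lift π e ≠ lift πstar e).card : ℝ) := by
  set S := univ.filter fun e : Edge n => R e.1.1 e.1.2 ∧ lift π e ≠ lift πstar e with hS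
  set A := univ.filter fun i => π i ≠ πstar i with hA
  set B : Fin n → Finset (Fin n) := fun i =>
    (univ.filter fun j => j ≠ i ∧ R i j).erase (πstar.symm (π i)) with hB
  have h1 : (A.sigma B).card ≤ 2 * S.card := by
    have hsub : (A.sigma B).card ≤ (S.image (fun e => e.1) ∪ S.image (fun e => e.1.swap)).card := by
      apply Finset.card_le_card_of_injOn (fun p => (p.1, p.2))
      · rintro ⟨i, j⟩ hp
        simp only [hA, hB, coe_sigma, Set.mem_sigma_iff, mem_coe, mem_filter, mem_univ, true_and,
          mem_erase] at hp
        obtain ⟨hi, hj, hji, hr⟩ := hp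
        have hj' : π i ≠ πstar j := fun h => hj (by rw [h]; simp)
        simp only [coe_union, Set.mem_union, mem_coe, mem_image]
        rcases lt_or_gt_of_ne hji with h | h
        · right
          refine ⟨⟨(j, i), h⟩, ?_, rfl⟩
          simp only [hS, mem_filter, mem_univ, true_and]
          exact ⟨hR _ _ hr, lift_ne_of _ _ _ (fun h => hi h.2) (fun h => hj' h.2)⟩
        · left
          refine ⟨⟨(i, j), h⟩, ?_, rfl⟩
          simp only [hS, mem_filter, mem_univ, true_and]
          exact ⟨hr, lift_ne_of _ _ _ (fun h => hi h.1) (fun h => hj' h.1)⟩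
      · rintro ⟨i, j⟩ _ ⟨i', j'⟩ _ h
        simp only [Prod.mk.injEq] at h
        obtain ⟨rfl, rfl⟩ := h
        rfl
    have := card_union_le (S.image (fun e => e.1)) (S.image (fun e => e.1.swap))
    have h3 : (S.image (fun e => e.1)).card ≤ S.card := card_image_le
    have h4 : (S.image (fun e => e.1.swap)).card ≤ S.card := card_image_le
    omega
  rw [card_sigma] at h1
  have h2 : (∑ i ∈ A, c) ≤ ∑ i ∈ A, ((B i).card : ℝ) := by
    apply sum_le_sum
    intro i _
    have h5 := hc i
    have h6 : (univ.filter fun j => j ≠ i ∧ R i j).card ≤ (B i).card + 1 :=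
      Nat.sub_le_iff_le_add.mp pred_card_le_card_erase
    have h7 : ((univ.filter fun j => j ≠ i ∧ R i j).card : ℝ) ≤ (B i).card + 1 := by
      exact_mod_cast h6
    linarith
  rw [sum_const, nsmul_eq_mul] at h2
  have h8 : (∑ i ∈ A, ((B i).card : ℝ)) ≤ 2 * S.card := by exact_mod_cast h1
  linarith

theorem sum_xcount {n k : ℕ} (σ : Fin n → Fin k) (πstar π : Equiv.Perm (Fin n)) :
    ∑ r, (xcount σ πstar π r : ℝ) = ((univ.filter fun i => π i ≠ πstar i).card : ℝ) := by
  rw [card_eq_sum_card_fiberwise (f := σ) (t := univ) (fun _ _ => by simp)]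
  push_cast
  refine sum_congr rfl fun r _ => ?_
  unfold xcount
  rw [filter_filter]
  simp only [and_comm]

/-- Lemma `lem:M bound 2`.
If the communities are `ε`-balanced and `(1-ε/2)n/k ≥ 4/ε`, then without any restriction
on the mismatch numbers `x_r`, `M⁺(τ) ≥ (1-ε)(n/(2k))(x_1+⋯+x_k)` and
`M⁻(τ) ≥ (1-ε)((k-1)n/(2k))(x_1+⋯+x_k)`. -/
theorem M_bound_general (n k : ℕ) (ε : ℝ) (hε : ε ∈ Set.Ioo (0 : ℝ) 1)
    (σ : Fin n → Fin k) (πstar π : Equiv.Perm (Fin n))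
    (hn : (4 : ℝ) / ε ≤ (1 - ε / 2) * n / k)
    (hbal : ∀ r, (1 - ε / 2) * n / k ≤ (Vcard σ r : ℝ)
        ∧ (Vcard σ r : ℝ) ≤ (1 + ε / 2) * n / k) :
    (1 - ε) * (n / (2 * k)) * (∑ r, (xcount σ πstar π r : ℝ)) ≤ (Mplus σ πstar π : ℝ) ∧
    (1 - ε) * (((k : ℝ) - 1) * n / (2 * k)) * (∑ r, (xcount σ πstar π r : ℝ))
      ≤ (Mminus σ πstar π : ℝ) := by
  obtain ⟨h0, h1⟩ := hε
  rcases Nat.eq_zero_or_pos k with rfl | hk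
  · have : 0 < 4 / ε := by positivity
    simp at hn
    linarith
  have hk' : (0 : ℝ) < k := by exact_mod_cast hk
  set a : ℝ := n / k with ha
  have ha0 : 0 ≤ a := by positivity
  have e1 : (1 - ε / 2) * n / k = (1 - ε / 2) * a := by rw [ha]; ring
  have hna : (n : ℝ) = k * a := by rw [ha]; field_simp
  have hεa : 4 ≤ ε * a := by
    rw [e1, div_le_iff₀ h0] at hn
    nlinarith [mul_nonneg h0.le ha0, mul_nonneg (mul_nonneg h0.le ha0) h0.le]
  rw [sum_xcount]
  have hV : ∀ r, (1 - ε / 2) * a ≤ Vcard σ r := fun r => by rw [← e1]; exact (hbal r).1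
  constructor
  · have := count_general (fun i j => σ i = σ j) (fun i j h => h.symm) πstar π ((1 - ε) * a) ?_
    · have e2 : (n : ℝ) / (2 * k) = a / 2 := by rw [ha]; field_simp
      rw [e2]
      unfold Mplus
      linarith
    · intro i
      have h2 : Vcard σ (σ i) ≤ (univ.filter fun j => j ≠ i ∧ σ i = σ j).card + 1 := by
        have : (univ.filter fun j => j ≠ i ∧ σ i = σ j)
            = (univ.filter fun j => σ j = σ i).erase i := by
          ext j; simp [eq_comm]
        rw [this]
        exact Nat.sub_le_iff_le_add.mp pred_card_le_card_erase
      have h3 : (Vcard σ (σ i) : ℝ) ≤ (univ.filter fun j => j ≠ i ∧ σ i = σ j).card + 1 := by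
        exact_mod_cast h2
      have := hV (σ i)
      linarith
  · have e2 : ((k : ℝ) - 1) * n / (2 * k) = (k - 1) * a / 2 := by rw [ha]; field_simp
    rw [e2]
    rcases Nat.eq_or_lt_of_le hk with hk1 | hk1
    · have : (k : ℝ) = 1 := by exact_mod_cast hk1.symm
      rw [this]
      simp
    have hk2 : (2 : ℝ) ≤ k := by exact_mod_cast hk1
    have := count_general (fun i j => σ i ≠ σ j) (fun i j h => h.symm) πstar π
      ((1 - ε) * ((k - 1) * a)) ?_
    · unfold Mminus
      linarith
    · intro i
      have h2 : (univ.filter fun j => j ≠ i ∧ σ i ≠ σ j).card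
          = ∑ r ∈ univ.erase (σ i), Vcard σ r := by
        rw [card_eq_sum_card_fiberwise (f := σ) (t := univ.erase (σ i))]
        · refine sum_congr rfl fun r hr => ?_
          unfold Vcard
          rw [filter_filter]
          congr 1
          ext j
          simp only [mem_filter, mem_univ, true_and, mem_erase] at hr ⊢
          constructor
          · exact fun h => h.2
          · rintro rfl
            exact ⟨⟨fun h => hr.1 (by rw [h]), fun h => hr.1 h.symm⟩, rfl⟩
        · intro j hj
          simp only [coe_filter, mem_univ, true_and, Set.mem_setOf_eq] at hj
          simpa using fun h => hj.2 h.symm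
      have h3 : ∑ r ∈ univ.erase (σ i), ((1 - ε / 2) * a)
          ≤ ∑ r ∈ univ.erase (σ i), (Vcard σ r : ℝ) := sum_le_sum fun r _ => hV r
      rw [sum_const, nsmul_eq_mul, card_erase_of_mem (mem_univ _), card_univ, Fintype.card_fin,
        Nat.cast_sub hk, Nat.cast_one] at h3
      rw [h2]
      push_cast
      nlinarith [mul_le_mul_of_nonneg_left hεa (by linarith : (0:ℝ) ≤ k - 1)]

end CSBM
end

section
/- In the correlated stochastic block model with π_* uniformly random on S_n, consider the MAP estimator π̂_MAP ∈ argmax_{π ∈ S_n} P(π_* = π | A, B, σ), where A, B are the adjacency matrices of G_1, G_2 and σ the community labels. Then for all sufficiently large n and every permutation π of [n], P(π̂_MAP = π | A, B, σ) ≤ Π_{r=1}^k 1/(|T_r^π|!), where T^π = {i ∈ [n] : A_{i,j}·B_{π(i),π(j)} = 0 for all j ∈ [n]} and T_r^π = T^π ∩ V_r. -/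
open Finset Filter

namespace CSBM

/-- Outcome of the correlated SBM with a uniformly random ground-truth permutation. -/
abbrev Omega' (n k : ℕ) := Equiv.Perm (Fin n) × Omega n k

/-- Joint density when `π⋆` is uniform on `S_n`, independent of everything else. -/
noncomputable def density' (n k : ℕ) (p q s : ℝ) (ω : Omega' n k) : ℝ :=
  ((n.factorial : ℝ))⁻¹ * density n k p q s ω.2

/-- Probability of an event under the CSBM with uniformly random `π⋆`. -/
noncomputable def Pr' (n k : ℕ) (p q s : ℝ) (A : Set (Omega' n k)) : ℝ :=
  ∑ ω : Omega' n k, Set.indicator A (density' n k p q s) ω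

/-- Joint probability `P(π⋆ = π, A = a, B = b, σ = σ₀)`. -/
noncomputable def jointP (n k : ℕ) (p q s : ℝ) (π : Equiv.Perm (Fin n))
    (a b : Fin n → Fin n → Bool) (σ₀ : Fin n → Fin k) : ℝ :=
  Pr' n k p q s {ω | ω.1 = π ∧ G1adj ω.2 = a ∧ G2adj ω.1 ω.2 = b ∧ ω.2.1 = σ₀}

/-- Probability of the observation `P(A = a, B = b, σ = σ₀)`. -/
noncomputable def margP (n k : ℕ) (p q s : ℝ)
    (a b : Fin n → Fin n → Bool) (σ₀ : Fin n → Fin k) : ℝ :=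
  Pr' n k p q s {ω | G1adj ω.2 = a ∧ G2adj ω.1 ω.2 = b ∧ ω.2.1 = σ₀}

/-- The posterior probability `P(π⋆ = π | A = a, B = b, σ = σ₀)`. -/
noncomputable def posterior (n k : ℕ) (p q s : ℝ) (π : Equiv.Perm (Fin n))
    (a b : Fin n → Fin n → Bool) (σ₀ : Fin n → Fin k) : ℝ :=
  jointP n k p q s π a b σ₀ / margP n k p q s a b σ₀

open scoped Classical in
/-- The set of posterior maximizers (MAP candidates) given the observation. -/
noncomputable def mapSet (n k : ℕ) (p q s : ℝ)
    (a b : Fin n → Fin n → Bool) (σ₀ : Fin n → Fin k) : Finset (Equiv.Perm (Fin n)) :=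
  univ.filter fun π => ∀ π', posterior n k p q s π' a b σ₀ ≤ posterior n k p q s π a b σ₀

open scoped Classical in
/-- `P(π̂_MAP = π | A = a, B = b, σ = σ₀)` for the MAP estimator with uniform tie-breaking
over the posterior maximizers. -/
noncomputable def mapProb (n k : ℕ) (p q s : ℝ) (π : Equiv.Perm (Fin n))
    (a b : Fin n → Fin n → Bool) (σ₀ : Fin n → Fin k) : ℝ :=
  (if π ∈ mapSet n k p q s a b σ₀ then 1 else 0) / (mapSet n k p q s a b σ₀).card

/-- `T^π`: vertices isolated in the intersection of `a` with the `π`-aligned `b`. -/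
def Tset {n : ℕ} (a b : Fin n → Fin n → Bool) (π : Equiv.Perm (Fin n)) : Finset (Fin n) :=
  univ.filter fun i => ∀ j, (a i j && b (π i) (π j)) = false

/-- `|T_r^π| = |T^π ∩ V_r|`. -/
def TrCard {n k : ℕ} (σ₀ : Fin n → Fin k) (a b : Fin n → Fin n → Bool)
    (π : Equiv.Perm (Fin n)) (r : Fin k) : ℕ :=
  (Tset a b π ∩ univ.filter fun i => σ₀ i = r).card

theorem adj_edge {n : ℕ} (g : Edge n → Bool) (e : Edge n) : adj g e.1.1 e.1.2 = g e := by
  unfold adj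
  rw [dif_pos e.2]

theorem adj_symm {n : ℕ} (g : Edge n → Bool) (i j : Fin n) : adj g i j = adj g j i := by
  unfold adj
  rcases lt_trichotomy i j with h | h | h
  · simp [h, h.not_gt]
  · subst h; simp
  · simp [h, h.not_gt]

theorem adj_self {n : ℕ} (g : Edge n → Bool) (i : Fin n) : adj g i i = false := by
  simp [adj]

theorem adj_and {n : ℕ} (g h : Edge n → Bool) (i j : Fin n) :
    (adj g i j && adj h i j) = adj (fun e => g e && h e) i j := by
  unfold adj
  split_ifs <;> simp

theorem adj_inj {n : ℕ} (g h : Edge n → Bool) : adj g = adj h ↔ ∀ e, g e = h e := by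
  constructor
  · intro H e
    rw [← adj_edge g e, ← adj_edge h e, H]
  · intro H
    rw [funext H]

theorem adj_lift {n : ℕ} (g : Edge n → Bool) (ρ : Equiv.Perm (Fin n)) (i j : Fin n) :
    adj (fun e => g (lift ρ e)) i j = adj g (ρ i) (ρ j) := by
  have key : ∀ i j : Fin n, i < j →
      adj (fun e => g (lift ρ e)) i j = adj g (ρ i) (ρ j) := by
    intro i j h
    have h1 := adj_edge (fun e => g (lift ρ e)) ⟨(i, j), h⟩
    simp only at h1
    rw [h1]
    unfold lift
    simp only
    split_ifs with h2
    · exact (adj_edge g ⟨(ρ i, ρ j), h2⟩).symm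
    · rw [adj_symm g (ρ i)]
      exact (adj_edge g ⟨(ρ j, ρ i), _⟩).symm
  rcases lt_trichotomy i j with h | h | h
  · exact key i j h
  · subst h; rw [adj_self, adj_self]
  · rw [adj_symm, adj_symm g]; exact key j i h

theorem lift_lift {n : ℕ} (ρ τ : Equiv.Perm (Fin n)) (h : ∀ i, τ (ρ i) = i) (e : Edge n) :
    lift τ (lift ρ e) = e := by
  obtain ⟨⟨i, j⟩, hij⟩ := e
  have hij' : i < j := hij
  unfold lift
  simp only
  split_ifs with h1 h2 h2
  · simp [h]
  · simp [h, hij'] at h2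
  · simp [h, hij'.not_gt] at h2
  · simp [h]

theorem class_lift {n k : ℕ} (σ : Fin n → Fin k) (ρ : Equiv.Perm (Fin n))
    (h : ∀ i, σ (ρ i) = σ i) (e : Edge n) :
    (σ (lift ρ e).1.1 = σ (lift ρ e).1.2) ↔ σ e.1.1 = σ e.1.2 := by
  unfold lift
  split_ifs with h1
  · simp [h]
  · simp [h, eq_comm]

/-- Joint weight of the pair of observed edge indicators. -/
noncomputable def ew (t s : ℝ) (x y : Bool) : ℝ :=
  ∑ g : Bool, ∑ m1 : Bool, ∑ m2 : Bool,
    if (g && m1) = x ∧ (g && m2) = y then bern t g * bern s m1 * bern s m2 else 0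

theorem bern_nonneg {t : ℝ} (ht : t ∈ Set.Icc (0 : ℝ) 1) (b : Bool) : 0 ≤ bern t b := by
  unfold bern
  split_ifs
  · exact ht.1
  · linarith [ht.2]

theorem ew_nonneg {t s : ℝ} (ht : t ∈ Set.Icc (0 : ℝ) 1) (hs : s ∈ Set.Icc (0 : ℝ) 1)
    (x y : Bool) : 0 ≤ ew t s x y := by
  unfold ew
  refine sum_nonneg fun g _ => sum_nonneg fun m1 _ => sum_nonneg fun m2 _ => ?_
  split_ifs
  · exact mul_nonneg (mul_nonneg (bern_nonneg ht _) (bern_nonneg hs _)) (bern_nonneg hs _)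
  · exact le_rfl

theorem ew_corr {t s : ℝ} (ht : t ∈ Set.Icc (0 : ℝ) 1) :
    ew t s true false * ew t s false true ≤ ew t s true true * ew t s false false := by
  simp [ew, bern]
  have : 0 ≤ t * (1 - t) * s ^ 2 := by
    have := ht.1
    have : 0 ≤ 1 - t := by linarith [ht.2]
    positivity
  nlinarith

theorem prod_four {ι : Type*} (S : Finset ι) (P : Bool → Bool → ℝ) (a f : ι → Bool) :
    ∏ e ∈ S, P (a e) (f e) =
      P true true ^ (#{e ∈ S | a e = true ∧ f e = true}) *
      P true false ^ (#{e ∈ S | a e = true ∧ f e = false}) *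
      P false true ^ (#{e ∈ S | a e = false ∧ f e = true}) *
      P false false ^ (#{e ∈ S | a e = false ∧ f e = false}) := by
  classical
  induction S using Finset.induction_on with
  | empty => simp
  | insert x S hx ih =>
    rw [prod_insert hx, ih]
    simp only [filter_insert]
    rcases ha : a x <;> rcases hf : f x <;> simp [hx, pow_succ] <;> ring

theorem swap_ineq {ι : Type*} (S : Finset ι) (P : Bool → Bool → ℝ) (hP : ∀ x y, 0 ≤ P x y)
    (hc : P true false * P false true ≤ P true true * P false false) (a f f' : ι → Bool)
    (hcard : #{e ∈ S | f e = true} = #{e ∈ S | f' e = true})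
    (hmono : ∀ e ∈ S, a e = true → f e = true → f' e = true) :
    ∏ e ∈ S, P (a e) (f e) ≤ ∏ e ∈ S, P (a e) (f' e) := by
  classical
  rw [prod_four, prod_four]
  have split : ∀ (p : ι → Prop) (q : ι → Bool) [DecidablePred p],
      #{e ∈ S | p e} = #{e ∈ S | p e ∧ q e = true} + #{e ∈ S | p e ∧ q e = false} := by
    intro p q _
    rw [← card_filter_add_card_filter_not (s := {e ∈ S | p e}) (fun e => q e = true)]
    simp [filter_filter]
  have hle : #{e ∈ S | a e = true ∧ f e = true} ≤ #{e ∈ S | a e = true ∧ f' e = true} := by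
    apply card_le_card
    intro e
    simp only [mem_filter]
    rintro ⟨h1, h2, h3⟩
    exact ⟨h1, h2, hmono e h1 h2 h3⟩
  have e1 := split (fun e => a e = true) f
  have e2 := split (fun e => a e = true) f'
  have e3 := split (fun e => a e = false) f
  have e4 := split (fun e => a e = false) f'
  have e5 := split (fun e => f e = true) a
  have e6 := split (fun e => f' e = true) a
  simp only [and_comm (a := f _ = true), and_comm (a := f' _ = true)] at e5 e6
  generalize #{e ∈ S | a e = true ∧ f e = true} = n11 at *
  generalize #{e ∈ S | a e = true ∧ f e = false} = n10 at *
  generalize #{e ∈ S | a e = false ∧ f e = true} = n01 at *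
  generalize #{e ∈ S | a e = false ∧ f e = false} = n00 at *
  generalize #{e ∈ S | a e = true ∧ f' e = true} = m11 at *
  generalize #{e ∈ S | a e = true ∧ f' e = false} = m10 at *
  generalize #{e ∈ S | a e = false ∧ f' e = true} = m01 at *
  generalize #{e ∈ S | a e = false ∧ f' e = false} = m00 at *
  obtain ⟨t, rfl⟩ := Nat.exists_eq_add_of_le hle
  obtain rfl : n10 = m10 + t := by omega
  obtain rfl : n01 = m01 + t := by omega
  obtain rfl : m00 = n00 + t := by omega
  have h0 := pow_le_pow_left₀ (mul_nonneg (hP _ _) (hP _ _)) hc t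
  have h1 : 0 ≤ P true true ^ n11 * P true false ^ m10 * P false true ^ m01
      * P false false ^ n00 := by
    have := hP true true
    have := hP true false
    have := hP false true
    have := hP false false
    positivity
  calc _ = P true true ^ n11 * P true false ^ m10 * P false true ^ m01
      * P false false ^ n00 * (P true false * P false true) ^ t := by ring
    _ ≤ P true true ^ n11 * P true false ^ m10 * P false true ^ m01
      * P false false ^ n00 * (P true true * P false false) ^ t :=
        mul_le_mul_of_nonneg_left h0 h1
    _ = _ := by ring

theorem density_nonneg {n k : ℕ} {p q s : ℝ} (hp : p ∈ Set.Icc (0 : ℝ) 1)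
    (hq : q ∈ Set.Icc (0 : ℝ) 1) (hs : s ∈ Set.Icc (0 : ℝ) 1) (ω : Omega' n k) :
    0 ≤ density' n k p q s ω := by
  unfold density' density
  have h1 : ∀ f : Edge n → Bool, 0 ≤ ∏ e : Edge n, bern s (f e) :=
    fun f => prod_nonneg fun e _ => bern_nonneg hs _
  have h2 : 0 ≤ ∏ e : Edge n, bern (if ω.2.1 e.1.1 = ω.2.1 e.1.2 then p else q) (ω.2.2.1 e) :=
    prod_nonneg fun e _ => bern_nonneg (by split_ifs <;> assumption) _
  have h3 := h1 ω.2.2.2.1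
  have h4 := h1 ω.2.2.2.2
  positivity

theorem Pr'_nonneg {n k : ℕ} {p q s : ℝ} (hp : p ∈ Set.Icc (0 : ℝ) 1)
    (hq : q ∈ Set.Icc (0 : ℝ) 1) (hs : s ∈ Set.Icc (0 : ℝ) 1) (A : Set (Omega' n k)) :
    0 ≤ Pr' n k p q s A :=
  sum_nonneg fun ω _ => Set.indicator_nonneg (fun ω _ => density_nonneg hp hq hs ω) ω

theorem G1_eq {n k : ℕ} (ω : Omega n k) : G1adj ω = adj (fun e => ω.2.1 e && ω.2.2.1 e) := by
  funext i j
  exact adj_and _ _ _ _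

theorem G2_iff {n k : ℕ} (π : Equiv.Perm (Fin n)) (ω : Omega n k) (b : Fin n → Fin n → Bool) :
    G2adj π ω = b ↔
      adj (fun e => ω.2.1 e && ω.2.2.2 e) = fun i j => b (π i) (π j) := by
  have h : ∀ i j, G2adj π ω i j = adj (fun e => ω.2.1 e && ω.2.2.2 e) (π.symm i) (π.symm j) :=
    fun i j => adj_and _ _ _ _
  constructor
  · rintro rfl
    funext i j
    simp [h]
  · intro H
    funext i j
    rw [h, H]
    simp

theorem sum_prod_fun {n : ℕ} (F : Edge n → Bool → ℝ) :
    ∑ x : Edge n → Bool, ∏ e, F e (x e) = ∏ e, ∑ y : Bool, F e y := by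
  rw [prod_univ_sum, Fintype.piFinset_univ]

theorem jointP_formula {n k : ℕ} (p q s : ℝ) (π : Equiv.Perm (Fin n))
    (a b : Fin n → Fin n → Bool) (σ₀ : Fin n → Fin k) (α β : Edge n → Bool)
    (ha : a = adj α) (hb : (fun i j => b (π i) (π j)) = adj β) :
    jointP n k p q s π a b σ₀ = (n.factorial : ℝ)⁻¹ * (k : ℝ)⁻¹ ^ n *
      ∏ e : Edge n, ew (if σ₀ e.1.1 = σ₀ e.1.2 then p else q) s (α e) (β e) := by
  classical
  unfold jointP Pr'
  have hmem : ∀ ω : Omega' n k, (ω ∈ {ω : Omega' n k | ω.1 = π ∧ G1adj ω.2 = a ∧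
      G2adj ω.1 ω.2 = b ∧ ω.2.1 = σ₀}) ↔ (ω.1 = π ∧ ω.2.1 = σ₀ ∧
        ∀ e, (ω.2.2.1 e && ω.2.2.2.1 e) = α e ∧ (ω.2.2.1 e && ω.2.2.2.2 e) = β e) := by
    intro ω
    simp only [Set.mem_ofPred_eq]
    constructor
    · rintro ⟨rfl, h2, h3, h4⟩
      rw [G1_eq, ha, adj_inj] at h2
      rw [G2_iff, hb, adj_inj] at h3
      exact ⟨rfl, h4, fun e => ⟨h2 e, h3 e⟩⟩
    · rintro ⟨rfl, h2, h3⟩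
      refine ⟨rfl, ?_, ?_, h2⟩
      · rw [G1_eq, ha, adj_inj]; exact fun e => (h3 e).1
      · rw [G2_iff, hb, adj_inj]; exact fun e => (h3 e).2
  simp only [Set.indicator_apply, hmem]
  rw [Fintype.sum_prod_type]
  rw [sum_eq_single π (by intro x _ hx; simp [hx]) (by simp)]
  rw [Fintype.sum_prod_type]
  rw [sum_eq_single σ₀ (by intro x _ hx; simp [hx]) (by simp)]
  simp only [true_and]
  unfold ew
  simp_rw [← sum_prod_fun, Fintype.sum_prod_type, mul_sum]
  refine sum_congr rfl fun g _ => sum_congr rfl fun m1 _ => sum_congr rfl fun m2 _ => ?_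
  split_ifs with h
  · rw [prod_congr rfl fun e _ => if_pos (h e)]
    simp only [density', density, prod_mul_distrib]
    ring
  · push Not at h
    obtain ⟨e, he⟩ := h
    rw [prod_eq_zero (mem_univ e), mul_zero]
    rw [if_neg]
    exact fun h => he h.1 h.2

theorem lift_fix {n : ℕ} (ρ : Equiv.Perm (Fin n)) (e : Edge n) (h1 : ρ e.1.1 = e.1.1)
    (h2 : ρ e.1.2 = e.1.2) : lift ρ e = e := by
  unfold lift
  rw [dif_pos (by rw [h1, h2]; exact e.2)]
  apply Subtype.ext
  simp only [h1, h2]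

theorem jointP_mono {n k : ℕ} {p q s : ℝ} (hp : p ∈ Set.Icc (0 : ℝ) 1)
    (hq : q ∈ Set.Icc (0 : ℝ) 1) (hs : s ∈ Set.Icc (0 : ℝ) 1) (π ρ : Equiv.Perm (Fin n))
    (a b : Fin n → Fin n → Bool) (σ₀ : Fin n → Fin k)
    (hσ : ∀ i, σ₀ (ρ i) = σ₀ i) (hT : ∀ i, i ∉ Tset a b π → ρ i = i) :
    jointP n k p q s π a b σ₀ ≤ jointP n k p q s (π * ρ) a b σ₀ := by
  classical
  by_cases h0 : jointP n k p q s π a b σ₀ = 0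
  · rw [h0]; exact Pr'_nonneg hp hq hs _
  obtain ⟨ω, -, hω⟩ := exists_ne_zero_of_sum_ne_zero h0
  obtain ⟨h1, h2, h3, h4⟩ := Set.mem_of_indicator_ne_zero hω
  rw [h1] at h3
  rw [G1_eq] at h2
  rw [G2_iff] at h3
  generalize (fun e => ω.2.2.1 e && ω.2.2.2.1 e) = α at h2
  generalize (fun e => ω.2.2.1 e && ω.2.2.2.2 e) = β at h3
  have h3' : (fun i j => b ((π * ρ) i) ((π * ρ) j)) = adj (fun e => β (lift ρ e)) := by
    funext i j
    rw [adj_lift, h3]; rfl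
  rw [jointP_formula p q s π a b σ₀ α β h2.symm h3.symm,
    jointP_formula p q s (π * ρ) a b σ₀ α _ h2.symm h3']
  apply mul_le_mul_of_nonneg_left _ (by positivity)
  have hmono : ∀ e, α e = true → β e = true → β (lift ρ e) = true := by
    intro e hα hβ
    have hae : a e.1.1 e.1.2 = true := by rw [← h2, adj_edge, hα]
    have hae' : a e.1.2 e.1.1 = true := by rw [← h2, adj_symm, adj_edge, hα]
    have hbe : b (π e.1.1) (π e.1.2) = true := by
      rw [← hβ, ← adj_edge β e, h3]
    have hbe' : b (π e.1.2) (π e.1.1) = true := by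
      rw [← hβ, ← adj_edge β e, adj_symm, h3]
    rw [lift_fix, hβ]
    · apply hT
      intro hmem
      have := (mem_filter.1 hmem).2 e.1.2
      simp [hae, hbe] at this
    · apply hT
      intro hmem
      have := (mem_filter.1 hmem).2 e.1.1
      simp [hae', hbe'] at this
  have hcl := class_lift σ₀ ρ hσ
  have hr : ∀ e, lift ρ (lift ρ.symm e) = e := lift_lift _ _ (by simp)
  have hl : ∀ e, lift ρ.symm (lift ρ e) = e := lift_lift _ _ (by simp)
  have hcard : ∀ (Q : Prop → Prop), #{e ∈ {e : Edge n | Q (σ₀ e.1.1 = σ₀ e.1.2)} | β e = true} =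
      #{e ∈ {e : Edge n | Q (σ₀ e.1.1 = σ₀ e.1.2)} | β (lift ρ e) = true} := by
    intro Q
    refine (card_nbij' (lift ρ) (lift ρ.symm) ?_ ?_ ?_ ?_).symm
    · intro e
      simp only [coe_filter, mem_filter, mem_univ, true_and, Set.mem_ofPred_eq]
      rw [propext (hcl e)]; exact id
    · intro e
      simp only [coe_filter, mem_filter, mem_univ, true_and, Set.mem_ofPred_eq]
      have := hcl (lift ρ.symm e)
      rw [hr] at this
      rw [hr, propext this]; exact id
    · intro e _; exact hl e
    · intro e _; exact hr e
  rw [← prod_filter_mul_prod_filter_not univ (fun e : Edge n => σ₀ e.1.1 = σ₀ e.1.2),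
    ← prod_filter_mul_prod_filter_not univ (fun e : Edge n => σ₀ e.1.1 = σ₀ e.1.2)
      (fun e => ew (if σ₀ e.1.1 = σ₀ e.1.2 then p else q) s (α e) (β (lift ρ e)))]
  have c1 : ∀ γ : Edge n → Bool,
      ∏ e : Edge n with σ₀ e.1.1 = σ₀ e.1.2,
        ew (if σ₀ e.1.1 = σ₀ e.1.2 then p else q) s (α e) (γ e) =
      ∏ e : Edge n with σ₀ e.1.1 = σ₀ e.1.2, ew p s (α e) (γ e) :=
    fun γ => prod_congr rfl fun e he => by rw [if_pos (mem_filter.1 he).2]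
  have c2 : ∀ γ : Edge n → Bool,
      ∏ e : Edge n with ¬ σ₀ e.1.1 = σ₀ e.1.2,
        ew (if σ₀ e.1.1 = σ₀ e.1.2 then p else q) s (α e) (γ e) =
      ∏ e : Edge n with ¬ σ₀ e.1.1 = σ₀ e.1.2, ew q s (α e) (γ e) :=
    fun γ => prod_congr rfl fun e he => by rw [if_neg (mem_filter.1 he).2]
  rw [c1, c2, c1 fun e => β (lift ρ e), c2 fun e => β (lift ρ e)]
  refine mul_le_mul ?_ ?_ (prod_nonneg fun e _ => ew_nonneg hq hs _ _)
    (prod_nonneg fun e _ => ew_nonneg hp hs _ _)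
  · exact swap_ineq _ (ew p s) (ew_nonneg hp hs) (ew_corr hp) α β _
      (by convert hcard id using 3 <;> simp) fun e _ => hmono e
  · exact swap_ineq _ (ew q s) (ew_nonneg hq hs) (ew_corr hq) α β _
      (by convert hcard Not) fun e _ => hmono e

/-- Label that separates vertices outside `T`. -/
def lab {n k : ℕ} (σ₀ : Fin n → Fin k) (T : Finset (Fin n)) (i : Fin n) : Fin k ⊕ Fin n :=
  if i ∈ T then Sum.inl (σ₀ i) else Sum.inr i

theorem lab_spec {n k : ℕ} (σ₀ : Fin n → Fin k) (T : Finset (Fin n)) (ρ : Equiv.Perm (Fin n))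
    (h : lab σ₀ T ∘ ρ = lab σ₀ T) : (∀ i, σ₀ (ρ i) = σ₀ i) ∧ ∀ i, i ∉ T → ρ i = i := by
  have key : ∀ i, i ∉ T → ρ i = i := by
    intro i hi
    have := congrFun h i
    simp only [lab, Function.comp, hi, if_false] at this
    split_ifs at this
    exact Sum.inr_injective this
  refine ⟨fun i => ?_, key⟩
  by_cases hi : i ∈ T
  · have := congrFun h i
    simp only [lab, Function.comp, hi, if_true] at this
    split_ifs at this
    exact Sum.inl_injective this
  · rw [key i hi]

theorem lab_card {n k : ℕ} (σ₀ : Fin n → Fin k) (T : Finset (Fin n)) :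
    Fintype.card {ρ : Equiv.Perm (Fin n) // lab σ₀ T ∘ ρ = lab σ₀ T} =
      ∏ r : Fin k, ((T ∩ univ.filter fun i => σ₀ i = r).card).factorial := by
  classical
  rw [DomMulAct.stabilizer_card, Fintype.prod_sum_type]
  rw [show (∏ j : Fin n, (Fintype.card {i // lab σ₀ T i = Sum.inr j}).factorial) = 1 from ?_]
  · rw [mul_one]
    refine prod_congr rfl fun r _ => ?_
    congr 1
    rw [Fintype.card_subtype]
    congr 1
    ext i
    rw [mem_filter, mem_inter, mem_filter]
    by_cases hi : i ∈ T <;> simp [lab, hi]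
  · refine prod_eq_one fun j _ => ?_
    rw [Nat.factorial_eq_one, Fintype.card_le_one_iff_subsingleton]
    refine ⟨?_⟩
    rintro ⟨x, hx⟩ ⟨y, hy⟩
    apply Subtype.ext
    have : ∀ x, lab σ₀ T x = Sum.inr j → x = j := by
      intro x hx
      unfold lab at hx
      split_ifs at hx
      exact Sum.inr_injective hx
    simp only
    rw [this x hx, this y hy]

/-- Lemma `lem:MAP estimator`.
For all sufficiently large `n`, every observation `(a, b, σ₀)` and every permutation `π`,
`P(π̂_MAP = π | A = a, B = b, σ = σ₀) ≤ ∏_{r=1}^k 1/(|T_r^π|!)`. -/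
theorem map_estimator_bound
    (p q s : ℕ → ℝ) (k : ℕ → ℕ)
    (hp01 : ∀ n, p n ∈ Set.Icc (0 : ℝ) 1) (hq01 : ∀ n, q n ∈ Set.Icc (0 : ℝ) 1)
    (hs01 : ∀ n, s n ∈ Set.Icc (0 : ℝ) 1) (hk1 : ∀ n, 1 ≤ k n) :
    ∃ N : ℕ, ∀ n ≥ N, ∀ (a b : Fin n → Fin n → Bool) (σ₀ : Fin n → Fin (k n))
      (π : Equiv.Perm (Fin n)),
      mapProb n (k n) (p n) (q n) (s n) π a b σ₀
        ≤ ∏ r : Fin (k n), ((TrCard σ₀ a b π r).factorial : ℝ)⁻¹ := by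
  classical
  refine ⟨0, fun n _ a b σ₀ π => ?_⟩
  have hpos : (0 : ℝ) < ∏ r : Fin (k n), ((TrCard σ₀ a b π r).factorial : ℝ) :=
    prod_pos fun r _ => by exact_mod_cast Nat.factorial_pos _
  rw [prod_inv_distrib]
  unfold mapProb
  split_ifs with hπ
  · rw [one_div]
    apply inv_anti₀ hpos
    have hc := lab_card σ₀ (Tset a b π)
    have : Fintype.card {ρ : Equiv.Perm (Fin n) // lab σ₀ (Tset a b π) ∘ ρ = lab σ₀ (Tset a b π)}
        ≤ (mapSet n (k n) (p n) (q n) (s n) a b σ₀).card := by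
      rw [← card_univ]
      refine card_le_card_of_injOn (fun ρ => π * ρ.1) ?_ ?_
      · rintro ⟨ρ, hρ⟩ -
        obtain ⟨h1, h2⟩ := lab_spec _ _ _ hρ
        have hm := jointP_mono (hp01 n) (hq01 n) (hs01 n) π ρ a b σ₀ h1 h2
        unfold mapSet at hπ ⊢
        simp only [coe_filter, mem_filter, mem_univ, true_and, Set.mem_ofPred_eq] at hπ ⊢
        intro π'
        refine (hπ π').trans ?_
        exact div_le_div_of_nonneg_right hm (Pr'_nonneg (hp01 n) (hq01 n) (hs01 n) _)
      · intro x _ y _ h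
        exact Subtype.ext (mul_left_cancel h)
    rw [hc] at this
    unfold TrCard
    exact_mod_cast this
  · rw [zero_div]
    exact (inv_pos.2 hpos).le

end CSBM
end

section
/- Let π_* be a permutation of [n], let σ : [n] → [k] with V_r = σ^{-1}(r), and let x_1,…,x_k be nonnegative integers with x_r ≤ |V_r| for each r. Then the number of permutations π of [n] satisfying |{i ∈ V_r : π(i) ≠ π_*(i)}| = x_r for every r ∈ [k] is at most n!/(n − x_1 − ⋯ − x_k)!, which is at most n^{x_1+⋯+x_k}. -/
open Finset

namespace CSBM

theorem aux_fiber {n : ℕ} (πstar : Equiv.Perm (Fin n)) (T : Finset (Fin n)) :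
    (univ.filter fun π : Equiv.Perm (Fin n) => (univ.filter fun i => π i ≠ πstar i) = T).card
      ≤ T.card.factorial := by
  classical
  have h1 : Fintype.card {f : Equiv.Perm (Fin n) // ∀ a, ¬ (a ∈ T) → f a = a}
      = T.card.factorial := by
    rw [← Fintype.card_congr (Equiv.Perm.subtypeEquivSubtypePerm (fun a => a ∈ T)),
      Fintype.card_perm, Fintype.card_coe]
  rw [← h1, Fintype.card_subtype]
  refine Finset.card_le_card_of_injOn (fun π => πstar⁻¹ * π) ?_ ?_
  · intro π hπ
    simp only [coe_filter, mem_univ, true_and, Set.mem_setOf_eq] at hπ ⊢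
    intro a ha
    rw [← hπ] at ha
    simp only [mem_filter, mem_univ, true_and, not_not] at ha
    simp [ha]
  · intro a _ b _ h
    exact mul_left_cancel h

/-- the counting bound `|S_{x_1,…,x_k}| ≤ n!/(n-Σx_r)! ≤ n^{Σ x_r}`.
The number of permutations with exactly `x_r` mismatched vertices in community `r`
(for every `r`) is at most `n!/(n - x_1 - ⋯ - x_k)!`, which is at most `n^{x_1+⋯+x_k}`. -/
theorem counting_bound (n k : ℕ) (πstar : Equiv.Perm (Fin n)) (σ : Fin n → Fin k)
    (x : Fin k → ℕ) (hx : ∀ r, x r ≤ Vcard σ r) :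
    (univ.filter fun π : Equiv.Perm (Fin n) => ∀ r, xcount σ πstar π r = x r).card
        ≤ n.factorial / (n - ∑ r, x r).factorial ∧
      n.factorial / (n - ∑ r, x r).factorial ≤ n ^ (∑ r, x r) := by
  classical
  have hS : ∑ r, x r ≤ n := by
    calc ∑ r, x r ≤ ∑ r, Vcard σ r := Finset.sum_le_sum fun r _ => hx r
      _ = n := by
        have := Finset.card_eq_sum_card_fiberwise (f := σ) (s := univ) (t := univ)
          (fun i _ => by simp)
        simp only [Finset.card_univ, Fintype.card_fin] at this
        exact this.symm
  rw [← Nat.descFactorial_eq_div hS]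
  refine ⟨?_, Nat.descFactorial_le_pow _ _⟩
  set S := ∑ r, x r with hSdef
  have hmaps : ∀ π ∈ (univ.filter fun π : Equiv.Perm (Fin n) => ∀ r, xcount σ πstar π r = x r),
      (univ.filter fun i => π i ≠ πstar i) ∈ powersetCard S (univ : Finset (Fin n)) := by
    intro π hπ
    simp only [mem_filter, mem_univ, true_and] at hπ
    rw [mem_powersetCard]
    refine ⟨subset_univ _, ?_⟩
    rw [Finset.card_eq_sum_card_fiberwise (f := σ) (t := univ) (fun i _ => by simp), hSdef]
    refine Finset.sum_congr rfl fun r _ => ?_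
    rw [← hπ r, xcount, filter_filter]
    congr 1
    ext i
    simp [and_comm]
  have := Finset.card_le_mul_card_image_of_maps_to hmaps S.factorial (by
    intro T hT
    rw [mem_powersetCard] at hT
    rw [← hT.2]
    refine le_trans (Finset.card_le_card ?_) (aux_fiber πstar T)
    rw [filter_filter]
    intro π hπ
    simp only [mem_filter, mem_univ, true_and] at hπ ⊢
    exact hπ.2)
  rwa [card_powersetCard, card_univ, Fintype.card_fin, ← Nat.descFactorial_eq_factorial_mul_choose] at this

end CSBM
end
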